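/- Assume (H0), (H1) and (H2). Then there exists a constant C such that for all μ, ν ∈ P(E): sup_{x∈E} ‖A_μ(x,·) − A_ν(x,·)‖_TV ≤ C‖μ−ν‖_TV, and ‖Π_μ − Π_ν‖_TV ≤ C‖μ−ν‖_TV; i.e., μ ↦ A_μ is Lipschitz for the TV norm uniformly in x, and μ ↦ Π_μ is Lipschitz for the TV norm. -/

import Mathlib

open MeasureTheory Filter Topology
open scoped ENNReal NNReal

noncomputable section

namespace QSD

variable {E : Type*}

/-- `n`-fold iterate of a sub-Markov kernel given as a measure-valued map:
`kIter K 0 x = δ_x` and `kIter K (n+1) x = (K x).bind (kIter K n)`. -/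
def kIter [MeasurableSpace E] (K : E → Measure E) : ℕ → E → Measure E
  | 0, x => Measure.dirac x
  | n + 1, x => (K x).bind (kIter K n)

/-- Total variation distance between two measures: supremum over measurable sets
of the absolute difference of the masses. -/
def tvDist [MeasurableSpace E] (μ ν : Measure E) : ℝ :=
  ⨆ A : {s : Set E // MeasurableSet s}, |(μ (A : Set E)).toReal - (ν (A : Set E)).toReal|

/-- The kernel `A_μ(x,·) = Σ_{n≥0} K_{μ,∂}^n(x,·)`. -/
def Aker [MeasurableSpace E] (K : E → Measure E) (x : E) : Measure E :=
  Measure.sum fun n => kIter K n x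

/-- `Π_μ = μ A_μ / (μ A_μ)(E)`. -/
def Pim [MeasurableSpace E] (K : E → Measure E) (μ : Measure E) : Measure E :=
  ((μ.bind (Aker K)) Set.univ)⁻¹ • μ.bind (Aker K)

/-- The kernel with redistribution (rebirth) `𝕂_μ(x,·) = K_{μ,∂}(x,·) + δ_μ(x)·μ(·)`,
where `δ_μ(x) = 1 - K_{μ,∂}(x,E)`. -/
def Kret [MeasurableSpace E] (K : E → Measure E) (μ : Measure E) (x : E) : Measure E :=
  K x + (1 - K x Set.univ) • μ

/-- Iterated application of a family of kernels to the constant function `𝟙`: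
`chainV K [μ₁,…,μ_k] x = (K_{μ₁}(K_{μ₂}(⋯(K_{μ_k} 𝟙)⋯)))(x)`. -/
def chainV {V : Type*} [MeasurableSpace V] {I : Type*} (K : I → V → Measure V) :
    List I → V → ℝ≥0∞
  | [], _ => 1
  | μ :: L, x => ∫⁻ y, chainV K L y ∂(K μ x)

end QSD

open QSD

open scoped BoundedContinuousFunction

namespace QSD

section TotalVariation

variable {E : Type*} [MeasurableSpace E]

lemma abs_measure_sub_le_tvDist (μ ν : Measure E) [IsFiniteMeasure μ] [IsFiniteMeasure ν]
    {A : Set E} (hA : MeasurableSet A) :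
    |(μ A).toReal - (ν A).toReal| ≤ tvDist μ ν := by
  have hb : BddAbove (Set.range fun A : {s : Set E // MeasurableSet s} =>
      |(μ (A : Set E)).toReal - (ν (A : Set E)).toReal|) := by
    refine ⟨(μ Set.univ).toReal + (ν Set.univ).toReal, ?_⟩
    rintro _ ⟨B, rfl⟩
    have h1 : (μ (B : Set E)).toReal ≤ (μ Set.univ).toReal :=
      ENNReal.toReal_mono (measure_ne_top _ _) (measure_mono (Set.subset_univ _))
    have h2 : (ν (B : Set E)).toReal ≤ (ν Set.univ).toReal :=
      ENNReal.toReal_mono (measure_ne_top _ _) (measure_mono (Set.subset_univ _))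
    have h3 : 0 ≤ (μ (B : Set E)).toReal := ENNReal.toReal_nonneg
    have h4 : 0 ≤ (ν (B : Set E)).toReal := ENNReal.toReal_nonneg
    exact abs_sub_le_iff.2 ⟨by linarith, by linarith⟩
  exact le_ciSup hb ⟨A, hA⟩

lemma tvDist_nonneg (μ ν : Measure E) : 0 ≤ tvDist μ ν :=
  Real.iSup_nonneg fun _ => abs_nonneg _

lemma tvDist_comm (μ ν : Measure E) : tvDist μ ν = tvDist ν μ := by
  simp only [tvDist, abs_sub_comm]

lemma measure_le_add_of_tvDist_le {μ ν : Measure E} [IsFiniteMeasure μ] [IsFiniteMeasure ν]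
    {r : ℝ} (h : tvDist μ ν ≤ r) {A : Set E} (hA : MeasurableSet A) :
    μ A ≤ ν A + ENNReal.ofReal r := by
  have h1 := (abs_sub_le_iff.1 ((abs_measure_sub_le_tvDist μ ν hA).trans h)).1
  rw [← ENNReal.ofReal_toReal (measure_ne_top μ A),
    ← ENNReal.ofReal_toReal (measure_ne_top ν A),
    ← ENNReal.ofReal_add ENNReal.toReal_nonneg ((tvDist_nonneg μ ν).trans h)]
  exact ENNReal.ofReal_le_ofReal (by linarith)

lemma tvDist_le_of_measure_le_add {μ ν : Measure E} [IsFiniteMeasure μ] [IsFiniteMeasure ν]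
    {d : ℝ≥0∞} (hd : d ≠ ∞) (h1 : ∀ A, MeasurableSet A → μ A ≤ ν A + d)
    (h2 : ∀ A, MeasurableSet A → ν A ≤ μ A + d) :
    tvDist μ ν ≤ d.toReal := by
  have key : ∀ a b : ℝ≥0∞, b ≠ ∞ → a ≤ b + d → a.toReal - b.toReal ≤ d.toReal := by
    intro a b hb hab
    have := ENNReal.toReal_mono (ENNReal.add_ne_top.2 ⟨hb, hd⟩) hab
    rw [ENNReal.toReal_add hb hd] at this
    linarith
  have : Nonempty {s : Set E // MeasurableSet s} := ⟨⟨∅, .empty⟩⟩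
  exact ciSup_le fun A => abs_sub_le_iff.2
    ⟨key _ _ (measure_ne_top _ _) (h1 A A.2), key _ _ (measure_ne_top _ _) (h2 A A.2)⟩

/-- A setwise bound between measures extends to bounded measurable functions. -/
lemma lintegral_le_add_of_measure_le_add {μ ν : Measure E} {d M : ℝ≥0∞} (hM : M ≠ ∞)
    (h : ∀ A, MeasurableSet A → μ A ≤ ν A + d) {f : E → ℝ≥0∞} (hf : Measurable f)
    (hfM : ∀ x, f x ≤ M) :
    ∫⁻ x, f x ∂μ ≤ ∫⁻ x, f x ∂ν + M * d := by
  have layer : ∀ κ : Measure E,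
      ∫⁻ x, f x ∂κ = ∫⁻ t in Set.Ioi (0 : ℝ), κ {x | t < (f x).toReal} := by
    intro κ
    rw [← lintegral_eq_lintegral_meas_lt κ (f := fun x => (f x).toReal)
      (Eventually.of_forall fun _ => ENNReal.toReal_nonneg) hf.ennreal_toReal.aemeasurable]
    exact lintegral_congr fun x =>
      (ENNReal.ofReal_toReal (ne_top_of_le_ne_top hM (hfM x))).symm
  rw [layer μ, layer ν]
  have hind : ∫⁻ t in Set.Ioi (0 : ℝ), (Set.Iio M.toReal).indicator (fun _ => d) t = M * d := by
    rw [lintegral_indicator measurableSet_Iio, lintegral_const,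
      Measure.restrict_restrict measurableSet_Iio, Measure.restrict_apply_univ, Set.inter_comm,
      Set.Ioi_inter_Iio, Real.volume_Ioo, sub_zero, ENNReal.ofReal_toReal hM, mul_comm]
  rw [← hind, ← lintegral_add_right _ (measurable_const.indicator measurableSet_Iio)]
  refine lintegral_mono fun t => ?_
  by_cases ht : t < M.toReal
  · simpa [Set.indicator, ht] using h _ (measurableSet_lt measurable_const hf.ennreal_toReal)
  · have : {x | t < (f x).toReal} = ∅ := by
      ext x
      simpa using (ENNReal.toReal_mono hM (hfM x)).trans (not_lt.1 ht)
    simp [this]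

end TotalVariation

section Potential

variable {E : Type*} [MeasurableSpace E] {K : E → Measure E}

lemma measurable_kIter (hK : Measurable K) : ∀ n, Measurable (kIter K n)
  | 0 => Measure.measurable_dirac
  | n + 1 => (Measure.measurable_bind' (measurable_kIter hK n)).comp hK

lemma measurable_Aker (hK : Measurable K) : Measurable (Aker K) := by
  refine Measure.measurable_of_measurable_coe _ fun s hs => ?_
  simp only [Aker, Measure.sum_apply _ hs]
  exact Measurable.tsum fun n =>
    (Measure.measurable_coe hs).comp (measurable_kIter hK n)

lemma kIter_succ_apply (hK : Measurable K) (n : ℕ) (x : E) {A : Set E} (hA : MeasurableSet A) :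
    kIter K (n + 1) x A = ∫⁻ y, kIter K n y A ∂(K x) :=
  Measure.bind_apply hA (measurable_kIter hK n).aemeasurable

lemma measurable_kIter_apply (hK : Measurable K) (n : ℕ) {A : Set E} (hA : MeasurableSet A) :
    Measurable fun x => kIter K n x A :=
  (Measure.measurable_coe hA).comp (measurable_kIter hK n)

lemma measurable_Aker_apply (hK : Measurable K) {A : Set E} (hA : MeasurableSet A) :
    Measurable fun x => Aker K x A :=
  (Measure.measurable_coe hA).comp (measurable_Aker hK)

lemma Aker_apply (x : E) {A : Set E} (hA : MeasurableSet A) :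
    Aker K x A = ∑' n, kIter K n x A :=
  Measure.sum_apply _ hA

lemma sum_range_succ_kIter_apply (hK : Measurable K) (n : ℕ) (x : E) {A : Set E}
    (hA : MeasurableSet A) :
    ∑ k ∈ Finset.range (n + 1), kIter K k x A
      = Measure.dirac x A + ∫⁻ y, ∑ k ∈ Finset.range n, kIter K k y A ∂(K x) := by
  rw [Finset.sum_range_succ', add_comm,
    lintegral_finsetSum _ fun k _ => measurable_kIter_apply hK k hA]
  simp only [kIter_succ_apply hK _ _ hA]
  rfl

/-- The potential kernel satisfies `A = I + K A`. -/
lemma Aker_apply_eq_dirac_add (hK : Measurable K) (x : E) {A : Set E} (hA : MeasurableSet A) :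
    Aker K x A = Measure.dirac x A + ∫⁻ y, Aker K y A ∂(K x) := by
  simp only [Aker_apply _ hA]
  rw [lintegral_tsum fun k => (measurable_kIter_apply hK k hA).aemeasurable,
    tsum_eq_zero_add' ENNReal.summable]
  simp only [kIter_succ_apply hK _ _ hA]
  rfl

lemma kIter_univ_le_one (hK : Measurable K) (hsub : ∀ x, K x Set.univ ≤ 1) (n : ℕ) (x : E) :
    kIter K n x Set.univ ≤ 1 := by
  induction n generalizing x with
  | zero => simp [kIter]
  | succ n ih =>
    rw [kIter_succ_apply hK _ _ .univ]
    calc ∫⁻ y, kIter K n y Set.univ ∂(K x) ≤ ∫⁻ _, 1 ∂(K x) := lintegral_mono ih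
      _ ≤ 1 := by simpa using hsub x

lemma kIter_add_univ_le (hK : Measurable K) {ℓ : ℕ} {ρ : ℝ≥0∞}
    (h : ∀ x, kIter K ℓ x Set.univ ≤ ρ) (n : ℕ) (x : E) :
    kIter K (n + ℓ) x Set.univ ≤ ρ * kIter K n x Set.univ := by
  induction n generalizing x with
  | zero => simpa [kIter] using h x
  | succ n ih =>
    rw [Nat.add_right_comm, kIter_succ_apply hK _ _ .univ, kIter_succ_apply hK _ _ .univ,
      ← lintegral_const_mul _ (measurable_kIter_apply hK n .univ)]
    exact lintegral_mono ih

lemma Aker_univ_le (hK : Measurable K) (hsub : ∀ x, K x Set.univ ≤ 1) {ℓ : ℕ} (hℓ : 1 ≤ ℓ)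
    {ρ : ℝ≥0∞} (hρ : ρ < 1) (h : ∀ x, kIter K ℓ x Set.univ ≤ ρ) (x : E) :
    Aker K x Set.univ ≤ ℓ * (1 - ρ)⁻¹ := by
  have hfix : (ℓ : ℝ≥0∞) + ρ * (ℓ * (1 - ρ)⁻¹) = ℓ * (1 - ρ)⁻¹ := by
    have h1 : (1 - ρ) * (1 - ρ)⁻¹ = 1 :=
      ENNReal.mul_inv_cancel (tsub_pos_of_lt hρ).ne' (by finiteness)
    calc (ℓ : ℝ≥0∞) + ρ * (ℓ * (1 - ρ)⁻¹)
        = ℓ * ((1 - ρ) * (1 - ρ)⁻¹) + ρ * (ℓ * (1 - ρ)⁻¹) := by rw [h1, mul_one]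
      _ = ((1 - ρ) + ρ) * (ℓ * (1 - ρ)⁻¹) := by ring
      _ = _ := by rw [tsub_add_cancel_of_le hρ.le, one_mul]
  rw [Aker_apply _ .univ]
  refine ENNReal.tsum_le_of_sum_range_le fun n => ?_
  induction n with
  | zero => simp
  | succ n ih =>
    calc ∑ k ∈ Finset.range (n + 1), kIter K k x Set.univ
        ≤ ∑ k ∈ Finset.range (ℓ + n), kIter K k x Set.univ :=
          Finset.sum_le_sum_of_subset (Finset.range_subset_range.2 (by omega))
      _ = ∑ k ∈ Finset.range ℓ, kIter K k x Set.univ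
          + ∑ k ∈ Finset.range n, kIter K (ℓ + k) x Set.univ := Finset.sum_range_add _ _ _
      _ ≤ ∑ k ∈ Finset.range ℓ, 1
          + ∑ k ∈ Finset.range n, ρ * kIter K k x Set.univ := by
          gcongr with k _ k _
          · exact kIter_univ_le_one hK hsub k x
          · rw [add_comm]
            exact kIter_add_univ_le hK h k x
      _ ≤ ℓ + ρ * (ℓ * (1 - ρ)⁻¹) := by
          rw [← Finset.mul_sum]
          gcongr
          simp
      _ = _ := hfix

/-- One-sided form of the resolvent identity `A_K - A_L = A_K (K - L) A_L`. -/
lemma Aker_apply_le_add {L : E → Measure E} (hK : Measurable K) (hL : Measurable L)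
    {M c : ℝ≥0∞} (hM : M ≠ ∞) (hKM : ∀ x, Aker K x Set.univ ≤ M)
    (hLM : ∀ x, Aker L x Set.univ ≤ M)
    (h : ∀ x A, MeasurableSet A → K x A ≤ L x A + c) (x : E) {A : Set E}
    (hA : MeasurableSet A) :
    Aker K x A ≤ Aker L x A + M * c * M := by
  have key : ∀ n x, ∑ k ∈ Finset.range n, kIter K k x A
      ≤ Aker L x A + M * c * ∑ k ∈ Finset.range n, kIter K k x Set.univ := by
    intro n
    induction n with
    | zero => simp
    | succ n ih =>
      intro x
      have hmeas : Measurable fun y => ∑ k ∈ Finset.range n, kIter K k y Set.univ :=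
        Finset.measurable_sum _ fun k _ => measurable_kIter_apply hK k .univ
      have hswap : ∫⁻ y, Aker L y A ∂(K x) ≤ ∫⁻ y, Aker L y A ∂(L x) + M * c :=
        lintegral_le_add_of_measure_le_add hM (h x) (measurable_Aker_apply hL hA)
          fun y => (measure_mono (Set.subset_univ A)).trans (hLM y)
      rw [sum_range_succ_kIter_apply hK _ _ hA, sum_range_succ_kIter_apply hK _ _ .univ,
        Aker_apply_eq_dirac_add hL x hA]
      calc Measure.dirac x A + ∫⁻ y, ∑ k ∈ Finset.range n, kIter K k y A ∂(K x)
          ≤ Measure.dirac x A + ∫⁻ y, (Aker L y A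
              + M * c * ∑ k ∈ Finset.range n, kIter K k y Set.univ) ∂(K x) := by
            gcongr with y
            exact ih y
        _ = Measure.dirac x A + (∫⁻ y, Aker L y A ∂(K x)
              + M * c * ∫⁻ y, ∑ k ∈ Finset.range n, kIter K k y Set.univ ∂(K x)) := by
            rw [lintegral_add_left (measurable_Aker_apply hL hA), lintegral_const_mul _ hmeas]
        _ ≤ Measure.dirac x A + (∫⁻ y, Aker L y A ∂(L x) + M * c
              + M * c * ∫⁻ y, ∑ k ∈ Finset.range n, kIter K k y Set.univ ∂(K x)) := by
            gcongr
        _ = _ := by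
            rw [measure_univ]
            ring
  rw [Aker_apply (K := K) _ hA]
  refine ENNReal.tsum_le_of_sum_range_le fun n => (key n x).trans ?_
  gcongr
  refine le_trans ?_ (hKM x)
  rw [Aker_apply _ .univ]
  exact ENNReal.sum_le_tsum _

lemma bind_Aker_apply (hK : Measurable K) (μ : Measure E) {A : Set E} (hA : MeasurableSet A) :
    μ.bind (Aker K) A = ∫⁻ x, Aker K x A ∂μ :=
  Measure.bind_apply hA (measurable_Aker hK).aemeasurable

lemma one_le_Aker_univ (hK : Measurable K) (x : E) : 1 ≤ Aker K x Set.univ := by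
  rw [Aker_apply_eq_dirac_add hK x .univ, measure_univ]
  exact le_self_add

lemma one_le_bind_Aker_univ (hK : Measurable K) (μ : Measure E) [IsProbabilityMeasure μ] :
    1 ≤ μ.bind (Aker K) Set.univ := by
  rw [bind_Aker_apply hK μ .univ]
  calc (1 : ℝ≥0∞) = ∫⁻ _, 1 ∂μ := by simp
    _ ≤ _ := lintegral_mono (one_le_Aker_univ hK)

lemma bind_Aker_univ_le (hK : Measurable K) {M : ℝ≥0∞} (hKM : ∀ x, Aker K x Set.univ ≤ M)
    (μ : Measure E) [IsProbabilityMeasure μ] : μ.bind (Aker K) Set.univ ≤ M := by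
  rw [bind_Aker_apply hK μ .univ]
  calc ∫⁻ x, Aker K x Set.univ ∂μ ≤ ∫⁻ _, M ∂μ := lintegral_mono hKM
    _ = M := by simp

lemma bind_Aker_apply_le_add {L : E → Measure E} (hK : Measurable K) (hL : Measurable L)
    {M c d : ℝ≥0∞} (hM : M ≠ ∞) (hLM : ∀ x, Aker L x Set.univ ≤ M)
    (h : ∀ x A, MeasurableSet A → Aker K x A ≤ Aker L x A + c)
    {μ ν : Measure E} [IsProbabilityMeasure μ]
    (hμν : ∀ A, MeasurableSet A → μ A ≤ ν A + d) {A : Set E} (hA : MeasurableSet A) :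
    μ.bind (Aker K) A ≤ ν.bind (Aker L) A + (M * d + c) := by
  rw [bind_Aker_apply hK _ hA, bind_Aker_apply hL _ hA]
  calc ∫⁻ x, Aker K x A ∂μ ≤ ∫⁻ x, (Aker L x A + c) ∂μ := lintegral_mono fun x => h x A hA
    _ = ∫⁻ x, Aker L x A ∂μ + c := by
        rw [lintegral_add_right _ measurable_const, lintegral_const, measure_univ, mul_one]
    _ ≤ ∫⁻ x, Aker L x A ∂ν + M * d + c := by
        gcongr
        exact lintegral_le_add_of_measure_le_add hM hμν (measurable_Aker_apply hL hA)
          fun y => (measure_mono (Set.subset_univ A)).trans (hLM y)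
    _ = _ := add_assoc _ _ _

end Potential

/-- Normalization is Lipschitz on measures of mass at least one. -/
lemma inv_smul_apply_le_add {E : Type*} [MeasurableSpace E] {m n : Measure E} {d : ℝ≥0∞}
    (hm : 1 ≤ m Set.univ) (hm' : m Set.univ ≠ ∞) (hn : 1 ≤ n Set.univ) (hn' : n Set.univ ≠ ∞)
    (h1 : ∀ A, MeasurableSet A → m A ≤ n A + d) (h2 : n Set.univ ≤ m Set.univ + d)
    {A : Set E} (hA : MeasurableSet A) :
    ((m Set.univ)⁻¹ • m) A ≤ ((n Set.univ)⁻¹ • n) A + 2 * d := by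
  simp only [Measure.smul_apply, smul_eq_mul]
  set a := m Set.univ
  set b := n Set.univ
  have ha : a⁻¹ ≤ 1 := ENNReal.inv_le_one.2 hm
  have haa : a⁻¹ * a = 1 := ENNReal.inv_mul_cancel (zero_lt_one.trans_le hm).ne' hm'
  have hbb : b⁻¹ * b = 1 := ENNReal.inv_mul_cancel (zero_lt_one.trans_le hn).ne' hn'
  have hnb : b⁻¹ * n A ≤ 1 := hbb ▸ by gcongr; exact measure_mono (Set.subset_univ A)
  calc a⁻¹ * m A ≤ a⁻¹ * (n A + d) := by gcongr; exact h1 A hA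
    _ = (b⁻¹ * n A) * (a⁻¹ * b) + a⁻¹ * d := by
        calc a⁻¹ * (n A + d) = (b⁻¹ * b) * (a⁻¹ * n A) + a⁻¹ * d := by rw [hbb]; ring
          _ = _ := by ring
    _ ≤ (b⁻¹ * n A) * (a⁻¹ * (a + d)) + a⁻¹ * d := by gcongr
    _ = b⁻¹ * n A + (b⁻¹ * n A) * (a⁻¹ * d) + a⁻¹ * d := by rw [mul_add a⁻¹, haa]; ring
    _ ≤ b⁻¹ * n A + 1 * (1 * d) + 1 * d := by gcongr
    _ = _ := by ring

end QSD

/-- Lemma 3.2: under (H0), (H1), (H2), the maps `μ ↦ A_μ` (uniformly in `x`)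
and `μ ↦ Π_μ` are Lipschitz for the total variation norm. -/
theorem stmt6
    {E : Type*} [TopologicalSpace E] [PolishSpace E]
    [MeasurableSpace E] [BorelSpace E]
    (K : ProbabilityMeasure E → E → Measure E)
    (hKmeas : ∀ μ, Measurable (K μ))
    (hKsub : ∀ μ x, K μ x Set.univ ≤ 1)
    -- (H0)
    (ℓ : ℕ) (hℓ : 1 ≤ ℓ) (ρ : ℝ≥0∞) (hρ : ρ < 1)
    (hH0 : ∀ (μ : ProbabilityMeasure E) (x : E), kIter (K μ) ℓ x Set.univ ≤ ρ)
    -- (H1)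
    (hFeller : ∀ (μ : ProbabilityMeasure E) (f : E →ᵇ ℝ),
      Continuous fun x => ∫ y, f y ∂(K μ x))
    (hWCont : ∀ f : E →ᵇ ℝ,
      Continuous fun μ : ProbabilityMeasure E => ∫ y, f y ∂((μ : Measure E).bind (K μ)))
    -- (H2)
    (C : ℝ) (hC : 0 < C)
    (hH2 : ∀ (μ ν : ProbabilityMeasure E) (x : E),
      tvDist (K μ x) (K ν x) ≤ C * tvDist (μ : Measure E) (ν : Measure E)) :
    ∃ C' : ℝ, ∀ μ ν : ProbabilityMeasure E,
      (∀ x : E, tvDist (Aker (K μ) x) (Aker (K ν) x)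
          ≤ C' * tvDist (μ : Measure E) (ν : Measure E)) ∧
      tvDist (Pim (K μ) (μ : Measure E)) (Pim (K ν) (ν : Measure E))
          ≤ C' * tvDist (μ : Measure E) (ν : Measure E) := by
  set M : ℝ≥0∞ := ℓ * (1 - ρ)⁻¹
  have hM : M ≠ ∞ :=
    ENNReal.mul_ne_top (by simp) (ENNReal.inv_ne_top.2 (tsub_pos_of_lt hρ).ne')
  have hAM : ∀ μ x, Aker (K μ) x Set.univ ≤ M := fun μ =>
    Aker_univ_le (hKmeas μ) (hKsub μ) hℓ hρ (hH0 μ)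
  have hKfin : ∀ μ x, IsFiniteMeasure (K μ x) := fun μ x =>
    ⟨(hKsub μ x).trans_lt ENNReal.one_lt_top⟩
  have hAfin : ∀ μ x, IsFiniteMeasure (Aker (K μ) x) := fun μ x =>
    ⟨(hAM μ x).trans_lt hM.lt_top⟩
  have hbfin : ∀ μ : ProbabilityMeasure E, (μ : Measure E).bind (Aker (K μ)) Set.univ ≠ ∞ :=
    fun μ => ne_top_of_le_ne_top hM (bind_Aker_univ_le (hKmeas μ) (hAM μ) μ)
  have hPfin : ∀ μ : ProbabilityMeasure E, IsFiniteMeasure (Pim (K μ) (μ : Measure E)) := by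
    refine fun μ => ⟨?_⟩
    rw [Pim, Measure.smul_apply, smul_eq_mul, ENNReal.inv_mul_cancel
      (zero_lt_one.trans_le (one_le_bind_Aker_univ (hKmeas μ) μ)).ne' (hbfin μ)]
    exact ENNReal.one_lt_top
  set c : ℝ≥0∞ := ENNReal.ofReal C
  let d : ProbabilityMeasure E → ProbabilityMeasure E → ℝ≥0∞ := fun μ ν =>
    ENNReal.ofReal (tvDist (μ : Measure E) (ν : Measure E))
  have hdcomm : ∀ μ ν, d μ ν = d ν μ := fun μ ν => by simp only [d, tvDist_comm]
  have hK : ∀ μ ν x A, MeasurableSet A → K μ x A ≤ K ν x A + c * d μ ν := by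
    intro μ ν x A hA
    rw [← ENNReal.ofReal_mul hC.le]
    exact measure_le_add_of_tvDist_le (hH2 μ ν x) hA
  have hA : ∀ μ ν x A, MeasurableSet A →
      Aker (K μ) x A ≤ Aker (K ν) x A + M * (c * d μ ν) * M := fun μ ν x A hA =>
    Aker_apply_le_add (hKmeas μ) (hKmeas ν) hM (hAM μ) (hAM ν) (hK μ ν) x hA
  have hB : ∀ μ ν : ProbabilityMeasure E, ∀ A, MeasurableSet A →
      (μ : Measure E).bind (Aker (K μ)) A
        ≤ (ν : Measure E).bind (Aker (K ν)) A + (M * d μ ν + M * (c * d μ ν) * M) :=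
    fun μ ν A hA' => bind_Aker_apply_le_add (hKmeas μ) (hKmeas ν) hM (hAM ν) (hA μ ν)
      (fun B hB => measure_le_add_of_tvDist_le le_rfl hB) hA'
  have hP : ∀ μ ν : ProbabilityMeasure E, ∀ A, MeasurableSet A →
      Pim (K μ) (μ : Measure E) A
        ≤ Pim (K ν) (ν : Measure E) A + 2 * (M * d μ ν + M * (c * d μ ν) * M) :=
    fun μ ν A hA' => inv_smul_apply_le_add (one_le_bind_Aker_univ (hKmeas μ) μ) (hbfin μ)
      (one_le_bind_Aker_univ (hKmeas ν) ν) (hbfin ν) (hB μ ν)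
      (by rw [hdcomm μ ν]; exact hB ν μ _ .univ) hA'
  set Λ : ℝ≥0∞ := 2 * (M + M * c * M)
  have hΛ : Λ ≠ ∞ := by finiteness
  have hPd : ∀ μ ν, 2 * (M * d μ ν + M * (c * d μ ν) * M) = Λ * d μ ν := fun μ ν => by
    simp only [Λ]; ring
  have hAd : ∀ μ ν, M * (c * d μ ν) * M ≤ Λ * d μ ν := fun μ ν => by
    rw [← hPd, two_mul]
    exact le_add_self.trans le_self_add
  have hreal : ∀ μ ν, (Λ * d μ ν).toReal
      = Λ.toReal * tvDist (μ : Measure E) (ν : Measure E) := fun μ ν => by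
    rw [ENNReal.toReal_mul, ENNReal.toReal_ofReal (tvDist_nonneg _ _)]
  have hfin : ∀ μ ν, Λ * d μ ν ≠ ∞ := fun μ ν => ENNReal.mul_ne_top hΛ ENNReal.ofReal_ne_top
  refine ⟨Λ.toReal, fun μ ν => ⟨fun x => ?_, ?_⟩⟩
  · rw [← hreal]
    refine tvDist_le_of_measure_le_add (hfin μ ν)
      (fun A hA' => (hA μ ν x A hA').trans (add_le_add_right (hAd μ ν) _)) fun A hA' => ?_
    rw [hdcomm μ ν]
    exact (hA ν μ x A hA').trans (add_le_add_right (hAd ν μ) _)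
  · rw [← hreal]
    refine tvDist_le_of_measure_le_add (hfin μ ν)
      (fun A hA' => hPd μ ν ▸ hP μ ν A hA') fun A hA' => ?_
    rw [hdcomm μ ν]
    exact hPd ν μ ▸ hP ν μ A hA'
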